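/- Let a, b : ℝ³ → ℂ³ be C² up to the boundary of Π, with a of compact axial support, and suppose that on ∂Π either (i) ⟨a, ν⟩ = ⟨b, ν⟩ = 0, or (ii) a = ⟨a, ν⟩·ν and b = ⟨b, ν⟩·ν (tangential components vanish). Then ∫_Π ⟨curl a, curl b⟩ dx = ∫_Π Σⱼ ⟨∂ⱼa, ∂ⱼb⟩ dx − ∫_Π (div a)·conj(div b) dx + R⁻¹·∫_{∂Π} (a₁·conj(b₁) + a₂·conj(b₂)) dS. -/

import Mathlib

noncomputable section

open MeasureTheory Real Complex

/-- Points of `ℝ³`. -/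
abbrev V3 := Fin 3 → ℝ
/-- Vectors of `ℂ³`. -/
abbrev C3 := Fin 3 → ℂ

/-- Partial derivative `∂ⱼ` of a complex scalar function on `ℝ³`. -/
def pd (j : Fin 3) (f : V3 → ℂ) (x : V3) : ℂ := fderiv ℝ f x (Pi.single j 1)

/-- Partial derivative `∂ⱼ` of a real scalar function on `ℝ³`. -/
def pdR (j : Fin 3) (f : V3 → ℝ) (x : V3) : ℝ := fderiv ℝ f x (Pi.single j 1)

/-- Partial derivative `∂ⱼ` of a vector field, taken componentwise. -/
def pdV (j : Fin 3) (a : V3 → C3) (x : V3) : C3 := fun i => pd j (fun y => a y i) x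

/-- curl a = (∂₂a₃ − ∂₃a₂, ∂₃a₁ − ∂₁a₃, ∂₁a₂ − ∂₂a₁)  (indices 0,1,2). -/
def vcurl (a : V3 → C3) (x : V3) : C3 :=
  ![pd 1 (fun y => a y 2) x - pd 2 (fun y => a y 1) x,
    pd 2 (fun y => a y 0) x - pd 0 (fun y => a y 2) x,
    pd 0 (fun y => a y 1) x - pd 1 (fun y => a y 0) x]

/-- div a = ∂₁a₁ + ∂₂a₂ + ∂₃a₃. -/
def vdiv (a : V3 → C3) (x : V3) : ℂ := ∑ j, pd j (fun y => a y j) x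

/-- The bilinear (unconjugated) cross product on ℂ³. -/
def cross (a b : C3) : C3 :=
  ![a 1 * b 2 - a 2 * b 1, a 2 * b 0 - a 0 * b 2, a 0 * b 1 - a 1 * b 0]

/-- The Hermitian inner product ⟨a, b⟩ = Σⱼ aⱼ · conj(bⱼ). -/
def hinner (a b : C3) : ℂ := ∑ j, a j * (starRingEnd ℂ) (b j)

/-- The gradient of a real function, viewed as a complex vector. -/
def gradC (g : V3 → ℝ) (x : V3) : C3 := fun j => (pdR j g x : ℂ)

/-- The Laplacian Δg = ∂₁²g + ∂₂²g + ∂₃²g of a real function. -/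
def lapR (g : V3 → ℝ) (x : V3) : ℝ := ∑ j, pdR j (fun y => pdR j g y) x

/-- The solid infinite circular cylinder Π of radius `R`. -/
def Cyl (R : ℝ) : Set V3 := {x | x 0 ^ 2 + x 1 ^ 2 < R ^ 2}

/-- The boundary ∂Π of the cylinder. -/
def bCyl (R : ℝ) : Set V3 := {x | x 0 ^ 2 + x 1 ^ 2 = R ^ 2}

/-- The outward unit normal of the cylinder at a boundary point. -/
def nuR (R : ℝ) (x : V3) : V3 := ![x 0 / R, x 1 / R, 0]

/-- The outward unit normal, viewed as a complex vector. -/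
def nuC (R : ℝ) (x : V3) : C3 := fun j => (nuR R x j : ℂ)

/-- The normal component ⟨z, ν⟩ of z ∈ ℂ³ at a boundary point of the cylinder. -/
def ncomp (R : ℝ) (x : V3) (z : C3) : ℂ := ∑ k, z k * (nuR R x k : ℂ)

/-- The normal derivative ∂_ν g = ⟨∇g, ν⟩ of a real function at a boundary point. -/
def dnu (R : ℝ) (g : V3 → ℝ) (x : V3) : ℝ := ∑ k, pdR k g x * nuR R x k

/-- The surface integral ∫_{∂Π} F dS = ∫_ℝ ∫₀^{2π} F(R cos θ, R sin θ, t)·R dθ dt. -/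
def surfInt (R : ℝ) (F : V3 → ℂ) : ℂ :=
  ∫ t : ℝ, ∫ θ in (0:ℝ)..(2 * π), F ![R * Real.cos θ, R * Real.sin θ, t] * (R : ℂ)

/-- `f` is `C^k` up to the boundary of the open set `S`: it is `k` times continuously
differentiable on an open neighborhood of the closure of `S`. -/
def UpTo {E : Type*} [NormedAddCommGroup E] [NormedSpace ℝ E]
    (k : ℕ) (S : Set V3) (f : V3 → E) : Prop :=
  ∃ U : Set V3, IsOpen U ∧ closure S ⊆ U ∧ ContDiffOn ℝ k f U

/-- `f` has compact axial support: it vanishes whenever `|x₃| ≥ T` for some `T > 0`. -/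
def AxialSupp {E : Type*} [Zero E] (f : V3 → E) : Prop :=
  ∃ T > 0, ∀ x : V3, T ≤ |x 2| → f x = 0

/-- The matrix W₀(μ)ⱼₖ = μ⁻¹(Δμ)δⱼₖ + μ⁻²(∂ⱼμ)(∂ₖμ) − μ⁻¹∂ⱼ∂ₖμ. -/
def W0 (μ : V3 → ℝ) (x : V3) (j k : Fin 3) : ℝ :=
  (μ x)⁻¹ * lapR μ x * (if j = k then 1 else 0)
    + ((μ x) ^ 2)⁻¹ * pdR j μ x * pdR k μ x
    - (μ x)⁻¹ * pdR j (fun y => pdR k μ y) x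

/-- The matrix W(μ)ⱼₖ = ((2μ)⁻¹Δμ − (4μ²)⁻¹|∇μ|²)δⱼₖ + μ⁻²(∂ⱼμ)(∂ₖμ) − μ⁻¹∂ⱼ∂ₖμ. -/
def Wm (μ : V3 → ℝ) (x : V3) (j k : Fin 3) : ℝ :=
  ((2 * μ x)⁻¹ * lapR μ x - (4 * (μ x) ^ 2)⁻¹ * (∑ i, (pdR i μ x) ^ 2))
      * (if j = k then 1 else 0)
    + ((μ x) ^ 2)⁻¹ * pdR j μ x * pdR k μ x
    - (μ x)⁻¹ * pdR j (fun y => pdR k μ y) x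

theorem hasFDerivAt_polar_symm (p : ℝ × ℝ) :
    ∃ P' : ℝ × ℝ →L[ℝ] ℝ × ℝ,
      HasFDerivAt (fun q : ℝ × ℝ => (q.1 * Real.cos q.2, q.1 * Real.sin q.2)) P' p ∧
      P' (1, 0) = (Real.cos p.2, Real.sin p.2) ∧
      P' (0, 1) = (-(p.1 * Real.sin p.2), p.1 * Real.cos p.2) := by
  have h1 : HasFDerivAt (fun q : ℝ × ℝ => q.1) (ContinuousLinearMap.fst ℝ ℝ ℝ) p := hasFDerivAt_fst
  have h2 : HasFDerivAt (fun q : ℝ × ℝ => q.2) (ContinuousLinearMap.snd ℝ ℝ ℝ) p := hasFDerivAt_snd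
  refine ⟨_, (h1.mul h2.cos).prodMk (h1.mul h2.sin), ?_, ?_⟩ <;> simp

/-- The divergence theorem on a planar disc. -/
theorem integral_disc_divergence {R : ℝ} (hR : 0 < R) {V : Set (ℝ × ℝ)} (hV : IsOpen V)
    (hRV : {p : ℝ × ℝ | p.1 ^ 2 + p.2 ^ 2 ≤ R ^ 2} ⊆ V) {u v : ℝ × ℝ → ℂ}
    (hu : ContDiffOn ℝ 1 u V) (hv : ContDiffOn ℝ 1 v V) :
    ∫ p in {p : ℝ × ℝ | p.1 ^ 2 + p.2 ^ 2 < R ^ 2}, (fderiv ℝ u p (1, 0) + fderiv ℝ v p (0, 1))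
      = ∫ θ in (0:ℝ)..(2 * π),
          (u (R * Real.cos θ, R * Real.sin θ) * (Real.cos θ : ℂ)
            + v (R * Real.cos θ, R * Real.sin θ) * (Real.sin θ : ℂ)) * (R : ℂ) := by
  set P : ℝ × ℝ → ℝ × ℝ := fun q => (q.1 * Real.cos q.2, q.1 * Real.sin q.2) with hP
  set h : ℝ × ℝ → ℂ := fun p => fderiv ℝ u p (1, 0) + fderiv ℝ v p (0, 1) with hh
  have hPc : Continuous P := by fun_prop
  have hPV : ∀ p : ℝ × ℝ, 0 ≤ p.1 → p.1 ≤ R → P p ∈ V := by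
    intro p h0 h1
    apply hRV
    change (p.1 * Real.cos p.2) ^ 2 + (p.1 * Real.sin p.2) ^ 2 ≤ R ^ 2
    have : (p.1 * Real.cos p.2) ^ 2 + (p.1 * Real.sin p.2) ^ 2 = p.1 ^ 2 := by
      linear_combination p.1 ^ 2 * Real.cos_sq_add_sin_sq p.2
    rw [this]
    gcongr
  have hIcc : ∀ p ∈ Set.Icc ((0:ℝ), -π) (R, π), P p ∈ V := fun p hp => hPV p hp.1.1 hp.2.1
  have hhc : ContinuousOn h V :=
    ((hu.continuousOn_fderiv_of_isOpen hV le_rfl).clm_apply continuousOn_const).add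
      ((hv.continuousOn_fderiv_of_isOpen hV le_rfl).clm_apply continuousOn_const)
  set f : ℝ × ℝ → ℂ := fun p =>
    (p.1 : ℂ) * (u (P p) * (Real.cos p.2 : ℂ) + v (P p) * (Real.sin p.2 : ℂ)) with hf
  set g : ℝ × ℝ → ℂ := fun p =>
    v (P p) * (Real.cos p.2 : ℂ) - u (P p) * (Real.sin p.2 : ℂ) with hg
  have hderiv : ∀ p, P p ∈ V → ∃ f' g' : ℝ × ℝ →L[ℝ] ℂ, HasFDerivAt f f' p ∧ HasFDerivAt g g' p ∧
      f' (1, 0) + g' (0, 1) = (p.1 : ℂ) * h (P p) := by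
    intro p hp
    obtain ⟨P', hP', h10, h01⟩ := hasFDerivAt_polar_symm p
    have hup := (((hu.differentiableOn one_ne_zero) _ hp).differentiableAt
      (hV.mem_nhds hp)).hasFDerivAt.comp p hP'
    have hvp := (((hv.differentiableOn one_ne_zero) _ hp).differentiableAt
      (hV.mem_nhds hp)).hasFDerivAt.comp p hP'
    have h1 : HasFDerivAt (fun q : ℝ × ℝ => (q.1 : ℂ))
        (Complex.ofRealCLM.comp (ContinuousLinearMap.fst ℝ ℝ ℝ)) p :=
      (Complex.ofRealCLM.comp (ContinuousLinearMap.fst ℝ ℝ ℝ)).hasFDerivAt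
    have h2 : HasFDerivAt (fun q : ℝ × ℝ => q.2) (ContinuousLinearMap.snd ℝ ℝ ℝ) p :=
      hasFDerivAt_snd
    have hc : HasFDerivAt (fun q : ℝ × ℝ => (Real.cos q.2 : ℂ)) _ p :=
      Complex.ofRealCLM.hasFDerivAt.comp p h2.cos
    have hs : HasFDerivAt (fun q : ℝ × ℝ => (Real.sin q.2 : ℂ)) _ p :=
      Complex.ofRealCLM.hasFDerivAt.comp p h2.sin
    refine ⟨_, _, h1.mul ((hup.mul hc).add (hvp.mul hs)), (hvp.mul hc).sub (hup.mul hs), ?_⟩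
    have e10 : (Real.cos p.2, Real.sin p.2) = Real.cos p.2 • ((1:ℝ), (0:ℝ))
        + Real.sin p.2 • ((0:ℝ), (1:ℝ)) := by simp
    have e01 : (-(p.1 * Real.sin p.2), p.1 * Real.cos p.2)
        = (-(p.1 * Real.sin p.2)) • ((1:ℝ), (0:ℝ)) + (p.1 * Real.cos p.2) • ((0:ℝ), (1:ℝ)) := by
      simp
    simp only [_root_.add_apply, _root_.sub_apply,
      _root_.smul_apply, ContinuousLinearMap.comp_apply, h10, h01, hh,
      ContinuousLinearMap.coe_fst', ContinuousLinearMap.coe_snd', Complex.ofRealCLM_apply,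
      smul_eq_mul, Function.comp_apply]
    change _ = (p.1 : ℂ) * (fderiv ℝ u (P p) (1, 0) + fderiv ℝ v (P p) (0, 1))
    change (p.1 : ℂ) * ((u (P p)) * _ + (Real.cos p.2 : ℂ) * fderiv ℝ u (P p) _
      + (v (P p) * _ + (Real.sin p.2 : ℂ) * fderiv ℝ v (P p) _)) + _
      + (v (P p) * _ + (Real.cos p.2 : ℂ) * fderiv ℝ v (P p) _
        - (u (P p) * _ + (Real.sin p.2 : ℂ) * fderiv ℝ u (P p) _)) = _
    rw [e10, e01]
    simp only [map_add, map_smul, Complex.real_smul]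
    push_cast
    have := Complex.cos_sq_add_sin_sq (p.2 : ℂ)
    simp
    linear_combination (p.1 : ℂ) * (fderiv ℝ u (P p) (1, 0) + fderiv ℝ v (P p) (0, 1)) * this
  have hpolar : ∫ p in {p : ℝ × ℝ | p.1 ^ 2 + p.2 ^ 2 < R ^ 2}, h p
      = ∫ p in Set.Icc ((0:ℝ), -π) (R, π), (p.1 : ℂ) * h (P p) := by
    have hm : MeasurableSet {p : ℝ × ℝ | p.1 ^ 2 + p.2 ^ 2 < R ^ 2} :=
      (isOpen_lt (by fun_prop) (by fun_prop)).measurableSet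
    rw [← integral_indicator hm, ← _root_.integral_comp_polarCoord_symm]
    have hT : polarCoord.target = Set.Ioi (0:ℝ) ×ˢ Set.Ioo (-π) π := rfl
    have hS : ∀ p : ℝ × ℝ, polarCoord.symm p = P p := fun p => rfl
    have hset : (Set.Icc ((0:ℝ), -π) (R, π) : Set (ℝ × ℝ)) =ᵐ[volume]
        (Set.Ioo 0 R ×ˢ Set.Ioo (-π) π : Set (ℝ × ℝ)) := by
      rw [← Set.Icc_prod_Icc, Measure.volume_eq_prod]
      exact Measure.set_prod_ae_eq Ioo_ae_eq_Icc.symm Ioo_ae_eq_Icc.symm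
    rw [setIntegral_congr_set hset, ← integral_indicator polarCoord.open_target.measurableSet,
      ← integral_indicator (measurableSet_Ioo.prod measurableSet_Ioo)]
    congr 1
    ext p
    have hmem : 0 < p.1 → (P p ∈ {p : ℝ × ℝ | p.1 ^ 2 + p.2 ^ 2 < R ^ 2} ↔ p.1 < R) := by
      intro hp
      change (p.1 * Real.cos p.2) ^ 2 + (p.1 * Real.sin p.2) ^ 2 < R ^ 2 ↔ _
      have : (p.1 * Real.cos p.2) ^ 2 + (p.1 * Real.sin p.2) ^ 2 = p.1 ^ 2 := by
        linear_combination p.1 ^ 2 * Real.cos_sq_add_sin_sq p.2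
      rw [this]
      exact pow_lt_pow_iff_left₀ hp.le hR.le two_ne_zero
    by_cases h0 : p ∈ Set.Ioi (0:ℝ) ×ˢ Set.Ioo (-π) π
    · rw [hT, Set.indicator_of_mem h0, hS, Complex.real_smul]
      by_cases h1 : p.1 < R
      · rw [Set.indicator_of_mem ((hmem h0.1).2 h1), Set.indicator_of_mem
          (show p ∈ Set.Ioo 0 R ×ˢ Set.Ioo (-π) π from ⟨⟨h0.1, h1⟩, h0.2⟩)]
      · rw [Set.indicator_of_notMem (fun hq => h1 ((hmem h0.1).1 hq)),
          Set.indicator_of_notMem (fun hq => h1 hq.1.2), mul_zero]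
    · rw [hT, Set.indicator_of_notMem h0,
        Set.indicator_of_notMem (fun hq => h0 ⟨hq.1.1, hq.2⟩)]
  have key : ∀ p ∈ Set.Icc ((0:ℝ), -π) (R, π),
      fderiv ℝ f p (1, 0) + fderiv ℝ g p (0, 1) = (p.1 : ℂ) * h (P p) := by
    intro p hp
    obtain ⟨f', g', h1, h2, h3⟩ := hderiv p (hIcc p hp)
    rw [h1.fderiv, h2.fderiv, h3]
  have hd : ∀ p ∈ Set.Icc ((0:ℝ), -π) (R, π), DifferentiableAt ℝ f p ∧ DifferentiableAt ℝ g p := by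
    intro p hp
    obtain ⟨f', g', h1, h2, -⟩ := hderiv p (hIcc p hp)
    exact ⟨h1.differentiableAt, h2.differentiableAt⟩
  have hsub : Set.Ioo (0:ℝ) R ×ˢ Set.Ioo (-π) π ⊆ Set.Icc ((0:ℝ), -π) (R, π) :=
    fun p hp => ⟨⟨hp.1.1.le, hp.2.1.le⟩, ⟨hp.1.2.le, hp.2.2.le⟩⟩
  have hint : IntegrableOn (fun p : ℝ × ℝ => (p.1 : ℂ) * h (P p))
      (Set.Icc ((0:ℝ), -π) (R, π)) := by
    apply ContinuousOn.integrableOn_compact isCompact_Icc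
    exact (by fun_prop : Continuous fun p : ℝ × ℝ => (p.1 : ℂ)).continuousOn.mul
      (hhc.comp hPc.continuousOn hIcc)
  have main := integral_divergence_prod_Icc_of_hasFDerivAt_of_le f g (fderiv ℝ f) (fderiv ℝ g)
    ((0:ℝ), -π) (R, π) ⟨hR.le, by simp [Real.pi_pos.le]⟩
    (fun p hp => (hd p hp).1.continuousAt.continuousWithinAt)
    (fun p hp => (hd p hp).2.continuousAt.continuousWithinAt)
    (fun p hp => (hd p (hsub hp)).1.hasFDerivAt)
    (fun p hp => (hd p (hsub hp)).2.hasFDerivAt)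
    (hint.congr_fun (fun p hp => (key p hp).symm) measurableSet_Icc)
  rw [setIntegral_congr_fun measurableSet_Icc key] at main
  rw [hpolar, main]
  have hper : Function.Periodic (fun θ : ℝ => f (R, θ)) (2 * π) := by
    intro θ
    simp only [hf, hP, Real.cos_add_two_pi, Real.sin_add_two_pi]
  have h5 := hper.intervalIntegral_add_eq (-π) 0
  rw [zero_add, show -π + 2 * π = π by ring] at h5
  have hg0 : ∀ r, g (r, π) = g (r, -π) := by
    intro r; simp [hg, hP]
  have hf0 : ∀ θ, f (0, θ) = 0 := by
    intro θ; simp [hf]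
  simp only [hg0, hf0, sub_self, zero_add, intervalIntegral.integral_zero, sub_zero]
  rw [h5]
  congr 1
  ext θ
  exact mul_comm _ _

/-- The measurable equivalence `x ↦ (x₂, (x₀, x₁))` splitting off the axial coordinate. -/
def axialEquiv : V3 ≃ᵐ ℝ × (ℝ × ℝ) :=
  (MeasurableEquiv.piFinSuccAbove (fun _ : Fin 3 => ℝ) 2).trans
    ((MeasurableEquiv.refl ℝ).prodCongr MeasurableEquiv.finTwoArrow)

theorem measurePreserving_axialEquiv : MeasurePreserving axialEquiv :=
  (volume_preserving_piFinSuccAbove (fun _ : Fin 3 => ℝ) 2).trans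
    ((MeasurePreserving.id _).prod (volume_preserving_finTwoArrow ℝ))

theorem axialEquiv_symm_apply (q : ℝ × (ℝ × ℝ)) :
    axialEquiv.symm q = ![q.2.1, q.2.2, q.1] := by
  rw [MeasurableEquiv.symm_apply_eq]
  rfl

theorem integral_eq_integral_axial (f : V3 → ℂ) :
    ∫ x, f x = ∫ q : ℝ × (ℝ × ℝ), f ![q.2.1, q.2.2, q.1] := by
  rw [← (measurePreserving_axialEquiv.symm axialEquiv).integral_comp'
    (g := f)]
  simp_rw [axialEquiv_symm_apply]

theorem integrable_axial {f : V3 → ℂ} (hf : Integrable f) :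
    Integrable (fun q : ℝ × (ℝ × ℝ) => f ![q.2.1, q.2.2, q.1]) := by
  have := ((measurePreserving_axialEquiv.symm axialEquiv).integrable_comp_emb
    axialEquiv.symm.measurableEmbedding).2 hf
  simpa only [Function.comp_def, axialEquiv_symm_apply] using this

theorem isOpen_Cyl (R : ℝ) : IsOpen (Cyl R) := isOpen_lt (by fun_prop) (by fun_prop)

theorem closedCyl_subset_closure {R : ℝ} (hR : 0 < R) :
    {x : V3 | x 0 ^ 2 + x 1 ^ 2 ≤ R ^ 2} ⊆ closure (Cyl R) := by
  intro x hx
  have hx : x 0 ^ 2 + x 1 ^ 2 ≤ R ^ 2 := hx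
  have hc : Continuous fun s : ℝ => (![s * x 0, s * x 1, x 2] : V3) := by
    refine continuous_pi fun i => ?_
    fin_cases i <;> simp <;> fun_prop
  have h1 : (1:ℝ) ∈ closure (Set.Ico (0:ℝ) 1) := by
    rw [closure_Ico zero_ne_one]; simp
  have := map_mem_closure hc h1 (t := Cyl R) (fun s hs => by
    change (s * x 0) ^ 2 + (s * x 1) ^ 2 < R ^ 2
    have h2 : s ^ 2 < 1 := by nlinarith [hs.1, hs.2]
    have h3 : (s * x 0) ^ 2 + (s * x 1) ^ 2 ≤ s ^ 2 * R ^ 2 := by nlinarith [sq_nonneg s]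
    nlinarith [pow_pos hR 2])
  convert this using 1
  ext i
  fin_cases i <;> simp

theorem integrableOn_Cyl {R : ℝ} {f : V3 → ℂ}
    (hf : ContinuousOn f {x : V3 | x 0 ^ 2 + x 1 ^ 2 ≤ R ^ 2}) (hs : AxialSupp f) :
    IntegrableOn f (Cyl R) := by
  obtain ⟨T, hT, hs⟩ := hs
  set K : Set V3 := {x : V3 | x 0 ^ 2 + x 1 ^ 2 ≤ R ^ 2}
  have hK : IsClosed K := isClosed_le (by fun_prop) (by fun_prop)
  have hc : IsCompact (K ∩ {x | |x 2| ≤ T}) := by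
    refine (isCompact_Icc (a := (fun _ => -(|R| + T) : V3))
      (b := fun _ => |R| + T)).of_isClosed_subset
      (hK.inter (isClosed_le (by fun_prop) (by fun_prop))) ?_
    rintro x ⟨hx, hx2⟩
    have hx : x 0 ^ 2 + x 1 ^ 2 ≤ R ^ 2 := hx
    have hx2 : |x 2| ≤ T := hx2
    have h0 : |x 0| ≤ |R| := sq_le_sq.1 (by nlinarith [sq_nonneg (x 1)])
    have h1 : |x 1| ≤ |R| := sq_le_sq.1 (by nlinarith [sq_nonneg (x 0)])
    have hb : ∀ i, |x i| ≤ |R| + T := by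
      intro i
      fin_cases i <;> simp only [Fin.zero_eta, Fin.mk_one, Fin.reduceFinMk] <;>
        linarith [abs_nonneg R]
    exact ⟨fun i => (abs_le.1 (hb i)).1, fun i => (abs_le.1 (hb i)).2⟩
  refine ((hf.mono Set.inter_subset_left).integrableOn_compact hc).of_forall_sdiff_eq_zero
    (isOpen_Cyl R).measurableSet ?_
  rintro x ⟨hx, hx2⟩
  apply hs
  by_contra hlt
  exact hx2 ⟨le_of_lt (show x 0 ^ 2 + x 1 ^ 2 < R ^ 2 from hx), (not_le.1 hlt).le⟩

theorem AxialSupp.pd {f : V3 → ℂ} (hf : AxialSupp f) (j : Fin 3) : AxialSupp (pd j f) := by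
  obtain ⟨T, hT, hf⟩ := hf
  refine ⟨T + 1, by linarith, fun x hx => ?_⟩
  have ho : IsOpen {y : V3 | T < |y 2|} := isOpen_lt (by fun_prop) (by fun_prop)
  have hz : f =ᶠ[nhds x] fun _ => 0 := by
    filter_upwards [ho.mem_nhds (show T < |x 2| by linarith)] with y hy
    exact hf y (le_of_lt hy)
  simp [_root_.pd, hz.fderiv_eq]

theorem AxialSupp.add {f g : V3 → ℂ} (hf : AxialSupp f) (hg : AxialSupp g) :
    AxialSupp (fun x => f x + g x) := by
  obtain ⟨T, hT, hf⟩ := hf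
  obtain ⟨S, hS, hg⟩ := hg
  refine ⟨max T S, lt_max_of_lt_left hT, fun x hx => ?_⟩
  simp [hf x ((le_max_left _ _).trans hx), hg x ((le_max_right _ _).trans hx)]

theorem AxialSupp.sub {f g : V3 → ℂ} (hf : AxialSupp f) (hg : AxialSupp g) :
    AxialSupp (fun x => f x - g x) := by
  obtain ⟨T, hT, hf⟩ := hf
  obtain ⟨S, hS, hg⟩ := hg
  refine ⟨max T S, lt_max_of_lt_left hT, fun x hx => ?_⟩
  simp [hf x ((le_max_left _ _).trans hx), hg x ((le_max_right _ _).trans hx)]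

theorem AxialSupp.mul_right {f : V3 → ℂ} (hf : AxialSupp f) (g : V3 → ℂ) :
    AxialSupp (fun x => f x * g x) := by
  obtain ⟨T, hT, hf⟩ := hf
  exact ⟨T, hT, fun x hx => by simp [hf x hx]⟩

theorem AxialSupp.sum {f : Fin 3 → V3 → ℂ} (hf : ∀ i, AxialSupp (f i)) :
    AxialSupp (fun x => ∑ i, f i x) := by
  simp only [Fin.sum_univ_three]
  exact ((hf 0).add (hf 1)).add (hf 2)

theorem contDiffOn_pd {U : Set V3} (hU : IsOpen U) {f : V3 → ℂ} {m n : ℕ}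
    (hf : ContDiffOn ℝ n f U) (hmn : m + 1 ≤ n) (j : Fin 3) : ContDiffOn ℝ m (pd j f) U :=
  (hf.fderiv_of_isOpen hU (by exact_mod_cast hmn)).clm_apply contDiffOn_const

/-- The derivative of `f` along a curve `γ`, expressed by partial derivatives. -/
theorem hasDerivAt_comp_curve {f : V3 → ℂ} {γ : ℝ → V3} {γ' : V3} {s : ℝ}
    (hf : DifferentiableAt ℝ f (γ s)) (hγ : HasDerivAt γ γ' s) :
    HasDerivAt (fun s => f (γ s)) (∑ j, (γ' j : ℂ) * pd j f (γ s)) s := by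
  have h := hf.hasFDerivAt.comp_hasDerivAt s hγ
  have e : γ' = ∑ j, γ' j • (Pi.single j 1 : V3) := by
    ext i; simp [Finset.sum_apply, Pi.single_apply]
  rw [e, map_sum] at h
  simp only [map_smul, Complex.real_smul] at h
  exact h

theorem fderiv_slice {f : V3 → ℂ} {p : ℝ × ℝ} {t : ℝ}
    (hf : DifferentiableAt ℝ f ![p.1, p.2, t]) :
    fderiv ℝ (fun q : ℝ × ℝ => f ![q.1, q.2, t]) p (1, 0) = pd 0 f ![p.1, p.2, t] ∧
    fderiv ℝ (fun q : ℝ × ℝ => f ![q.1, q.2, t]) p (0, 1) = pd 1 f ![p.1, p.2, t] := by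
  have h : HasFDerivAt (fun q : ℝ × ℝ => (![q.1, q.2, t] : V3))
      (ContinuousLinearMap.pi ![ContinuousLinearMap.fst ℝ ℝ ℝ, ContinuousLinearMap.snd ℝ ℝ ℝ, 0])
      p := by
    rw [hasFDerivAt_pi']
    intro i
    fin_cases i
    · exact hasFDerivAt_fst
    · exact hasFDerivAt_snd
    · exact hasFDerivAt_const _ _
  have h' := (hf.hasFDerivAt.comp p h).fderiv
  simp only [Function.comp_def] at h'
  rw [h']
  constructor <;>
  · simp only [ContinuousLinearMap.comp_apply, pd]
    congr 1
    ext i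
    fin_cases i <;> simp

/-- The divergence theorem on the cylinder for fields with compact axial support. -/
theorem integral_Cyl_divergence {R : ℝ} (hR : 0 < R) {U : Set V3} (hU : IsOpen U)
    (hRU : {x : V3 | x 0 ^ 2 + x 1 ^ 2 ≤ R ^ 2} ⊆ U) {F : V3 → C3}
    (hF : ∀ j, ContDiffOn ℝ 1 (fun x => F x j) U) (hs : ∀ j, AxialSupp (fun x => F x j)) :
    ∫ x in Cyl R, vdiv F x = surfInt R (fun x => ncomp R x (F x)) := by
  have hcont : ∀ j, ContinuousOn (pd j fun x => F x j) U := fun j =>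
    (contDiffOn_pd (m := 0) (n := 1) hU (by exact_mod_cast hF j) (by norm_num) j).continuousOn
  have hdiff : ∀ j, ∀ x ∈ U, DifferentiableAt ℝ (fun x => F x j) x := fun j x hx =>
    ((hF j).differentiableOn one_ne_zero x hx).differentiableAt (hU.mem_nhds hx)
  have hint : ∀ j, IntegrableOn (pd j fun x => F x j) (Cyl R) := fun j =>
    integrableOn_Cyl ((hcont j).mono hRU) ((hs j).pd j)
  have hm := (isOpen_Cyl R).measurableSet
  set D : Set (ℝ × ℝ) := {p | p.1 ^ 2 + p.2 ^ 2 < R ^ 2}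
  have hDm : MeasurableSet D := (isOpen_lt (by fun_prop) (by fun_prop)).measurableSet
  have hind : ∀ (f : V3 → ℂ) (p : ℝ × ℝ) (t : ℝ),
      (Cyl R).indicator f ![p.1, p.2, t] = D.indicator (fun p => f ![p.1, p.2, t]) p :=
    fun f p t => rfl
  have hDU : ∀ (p : ℝ × ℝ) (t : ℝ), p.1 ^ 2 + p.2 ^ 2 ≤ R ^ 2 → (![p.1, p.2, t] : V3) ∈ U :=
    fun p t hp => hRU hp
  have hax : ∫ x in Cyl R, pd 2 (fun x => F x 2) x = 0 := by
    have hI := integrable_axial ((integrable_indicator_iff hm).2 (hint 2))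
    rw [← integral_indicator hm, integral_eq_integral_axial, Measure.volume_eq_prod,
      integral_prod_symm _ hI]
    apply integral_eq_zero_of_ae
    filter_upwards with p
    simp only [hind, Pi.zero_apply]
    by_cases hp : p ∈ D
    · simp only [Set.indicator_of_mem hp]
      have hpU : ∀ t, (![p.1, p.2, t] : V3) ∈ U := fun t => hDU p t (le_of_lt hp)
      have hγ : ∀ t, HasDerivAt (fun t : ℝ => (![p.1, p.2, t] : V3)) ![0, 0, 1] t := by
        intro t
        rw [hasDerivAt_pi]
        intro i
        fin_cases i
        · exact hasDerivAt_const _ _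
        · exact hasDerivAt_const _ _
        · exact hasDerivAt_id _
      have hd : ∀ t, HasDerivAt (fun t : ℝ => F ![p.1, p.2, t] 2)
          (pd 2 (fun x => F x 2) ![p.1, p.2, t]) t := by
        intro t
        simpa [Fin.sum_univ_three] using hasDerivAt_comp_curve (hdiff 2 _ (hpU t)) (hγ t)
      obtain ⟨T, hT, hz⟩ := (hs 2).pd 2
      obtain ⟨S, hS, hzF⟩ := hs 2
      have hc : Continuous fun t : ℝ => pd 2 (fun x => F x 2) ![p.1, p.2, t] :=
        (hcont 2).comp_continuous
          (continuous_iff_continuousAt.2 fun t => (hγ t).continuousAt) hpU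
      set M := max T S
      have hM : 0 < M := lt_max_of_lt_left hT
      rw [← intervalIntegral.integral_eq_integral_of_support_subset (a := -M) (b := M),
        intervalIntegral.integral_eq_sub_of_hasDerivAt (fun t _ => hd t)
          (hc.intervalIntegrable _ _)]
      · have h1 : F ![p.1, p.2, M] 2 = 0 := hzF _ (by simp [abs_of_pos hM, M])
        have h2 : F ![p.1, p.2, -M] 2 = 0 := hzF _ (by simp [abs_of_pos hM, M])
        rw [h1, h2, sub_zero]
      · intro t ht
        by_contra hcon
        refine ht (hz _ ((le_max_left T S).trans ?_))
        change M ≤ |t|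
        by_contra! hlt
        exact hcon ⟨(abs_lt.1 hlt).1, (abs_lt.1 hlt).2.le⟩
    · simp [Set.indicator_of_notMem hp]
  have hcross : ∫ x in Cyl R, (pd 0 (fun x => F x 0) x + pd 1 (fun x => F x 1) x)
      = surfInt R (fun x => ncomp R x (F x)) := by
    have hI := integrable_axial ((integrable_indicator_iff hm).2 ((hint 0).add (hint 1)))
    rw [← integral_indicator hm, integral_eq_integral_axial, Measure.volume_eq_prod]
    refine (integral_prod _ hI).trans ?_
    unfold surfInt
    congr 1
    ext t
    simp only [hind]
    rw [integral_indicator hDm]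
    have hsl : ContDiff ℝ 1 fun q : ℝ × ℝ => (![q.1, q.2, t] : V3) := by
      rw [contDiff_pi]
      intro i
      fin_cases i
      · exact contDiff_fst
      · exact contDiff_snd
      · exact contDiff_const
    have hslice := fun j => (hF j).comp hsl.contDiffOn
      (Set.mapsTo_preimage (fun q : ℝ × ℝ => (![q.1, q.2, t] : V3)) U)
    have hmain := integral_disc_divergence hR (hU.preimage hsl.continuous)
      (fun p hp => hDU p t hp) (hslice 0) (hslice 1)
    refine (setIntegral_congr_fun hDm fun p hp => ?_).trans (hmain.trans ?_)
    · have hpU := hDU p t (le_of_lt hp)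
      exact congrArg₂ (· + ·) (fderiv_slice (hdiff 0 _ hpU)).1.symm
        (fderiv_slice (hdiff 1 _ hpU)).2.symm
    · congr 1
      ext θ
      have hRc : (R : ℂ) ≠ 0 := by exact_mod_cast hR.ne'
      simp only [ncomp, nuR, Fin.sum_univ_three, Function.comp_apply]
      simp [hRc]
  have hv : ∀ x, vdiv F x = (pd 0 (fun x => F x 0) x + pd 1 (fun x => F x 1) x)
      + pd 2 (fun x => F x 2) x := fun x => Fin.sum_univ_three _
  simp_rw [hv]
  refine (integral_add ((hint 0).add (hint 1)) (hint 2)).trans ?_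
  rw [hax, add_zero, ← hcross]
  rfl

theorem pd_add {f g : V3 → ℂ} {x : V3} (hf : DifferentiableAt ℝ f x) (hg : DifferentiableAt ℝ g x)
    (j : Fin 3) : pd j (fun y => f y + g y) x = pd j f x + pd j g x := by
  simp [pd, fderiv_fun_add hf hg]

theorem pd_sub {f g : V3 → ℂ} {x : V3} (hf : DifferentiableAt ℝ f x) (hg : DifferentiableAt ℝ g x)
    (j : Fin 3) : pd j (fun y => f y - g y) x = pd j f x - pd j g x := by
  simp [pd, fderiv_fun_sub hf hg]

theorem pd_mul {f g : V3 → ℂ} {x : V3} (hf : DifferentiableAt ℝ f x) (hg : DifferentiableAt ℝ g x)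
    (j : Fin 3) : pd j (fun y => f y * g y) x = f x * pd j g x + g x * pd j f x := by
  simp [pd, fderiv_fun_mul hf hg]

theorem pd_conj (f : V3 → ℂ) (j : Fin 3) (x : V3) :
    pd j (fun y => (starRingEnd ℂ) (f y)) x = (starRingEnd ℂ) (pd j f x) := by
  have := Complex.conjCLE.comp_fderiv (f := f) (x := x)
  exact congrArg (fun L : V3 →L[ℝ] ℂ => L (Pi.single j 1)) this

theorem pd_comm {U : Set V3} (hU : IsOpen U) {f : V3 → ℂ} (hf : ContDiffOn ℝ 2 f U) {x : V3}
    (hx : x ∈ U) (i j : Fin 3) : pd i (pd j f) x = pd j (pd i f) x := by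
  have hd : DifferentiableAt ℝ (fderiv ℝ f) x :=
    ((hf.fderiv_of_isOpen hU (m := 1) (by norm_num [one_add_one_eq_two])).differentiableOn
      one_ne_zero x hx).differentiableAt (hU.mem_nhds hx)
  have h : ∀ k l : Fin 3, pd k (pd l f) x
      = fderiv ℝ (fderiv ℝ f) x (Pi.single k 1) (Pi.single l 1) := by
    intro k l
    change fderiv ℝ (fun y => fderiv ℝ f y (Pi.single l 1)) x (Pi.single k 1) = _
    rw [fderiv_clm_apply hd (differentiableAt_const _)]
    simp
  rw [h, h]
  exact ((hf.contDiffAt (hU.mem_nhds hx)).isSymmSndFDerivAt (by simp)) _ _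

/-- The field `(a · ∇) c - (div c) a`, whose divergence is the null Lagrangian
`∑ᵢⱼ (∂ⱼaᵢ ∂ᵢcⱼ - ∂ᵢaᵢ ∂ⱼcⱼ)`. -/
def convectionField (a c : V3 → C3) (x : V3) : C3 :=
  fun j => ∑ i, a x i * pd i (fun y => c y j) x - a x j * vdiv c x

theorem vdiv_convectionField {U : Set V3} (hU : IsOpen U) {a c : V3 → C3}
    (ha : ∀ i, ContDiffOn ℝ 2 (fun y => a y i) U) (hc : ∀ i, ContDiffOn ℝ 2 (fun y => c y i) U)
    {x : V3} (hx : x ∈ U) :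
    vdiv (convectionField a c) x
      = ∑ j, ∑ i, pd j (fun y => a y i) x * pd i (fun y => c y j) x - vdiv a x * vdiv c x := by
  have hda : ∀ i, DifferentiableAt ℝ (fun y => a y i) x := fun i =>
    ((ha i).differentiableOn two_ne_zero x hx).differentiableAt (hU.mem_nhds hx)
  have hdc : ∀ i j, DifferentiableAt ℝ (fun y => pd i (fun y => c y j) y) x := fun i j =>
    ((contDiffOn_pd (m := 1) (n := 2) hU (by exact_mod_cast hc j) le_rfl i).differentiableOn
      (by norm_num) x hx).differentiableAt (hU.mem_nhds hx)
  have hpd : ∀ j, pd j (fun y => convectionField a c y j) x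
      = ∑ i, (a x i * pd j (pd i fun y => c y j) x
          + pd i (fun y => c y j) x * pd j (fun y => a y i) x)
        - (a x j * ∑ i, pd j (pd i fun y => c y i) x + vdiv c x * pd j (fun y => a y j) x) := by
    intro j
    have hm : ∀ i k, DifferentiableAt ℝ (fun y => a y i * pd i (fun y => c y k) y) x :=
      fun i k => (hda i).mul (hdc i k)
    simp only [convectionField, vdiv, Fin.sum_univ_three]
    rw [pd_sub (((hm 0 j).fun_add (hm 1 j)).fun_add (hm 2 j))
        ((hda j).fun_mul (((hdc 0 0).fun_add (hdc 1 1)).fun_add (hdc 2 2))),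
      pd_add ((hm 0 j).fun_add (hm 1 j)) (hm 2 j), pd_add (hm 0 j) (hm 1 j),
      pd_mul (hda j) (((hdc 0 0).fun_add (hdc 1 1)).fun_add (hdc 2 2)),
      pd_add ((hdc 0 0).fun_add (hdc 1 1)) (hdc 2 2), pd_add (hdc 0 0) (hdc 1 1),
      pd_mul (hda 0) (hdc 0 j), pd_mul (hda 1) (hdc 1 j), pd_mul (hda 2) (hdc 2 j)]
  have hcomm := fun k => fun i j => pd_comm hU (hc k) hx i j
  rw [vdiv]
  simp only [hpd]
  simp only [vdiv, Fin.sum_univ_three]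
  rw [hcomm 0 1 0, hcomm 0 2 0, hcomm 1 1 0, hcomm 1 2 1, hcomm 2 2 0, hcomm 2 2 1]
  ring

theorem hasDerivAt_bCyl_angle (R t θ : ℝ) :
    HasDerivAt (fun θ : ℝ => (![R * Real.cos θ, R * Real.sin θ, t] : V3))
      ![-(R * Real.sin θ), R * Real.cos θ, 0] θ := by
  rw [hasDerivAt_pi]
  intro i
  fin_cases i
  · simpa using (Real.hasDerivAt_cos θ).const_mul R
  · simpa using (Real.hasDerivAt_sin θ).const_mul R
  · exact hasDerivAt_const _ _

theorem hasDerivAt_bCyl_axis (R t θ : ℝ) :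
    HasDerivAt (fun t : ℝ => (![R * Real.cos θ, R * Real.sin θ, t] : V3)) ![0, 0, 1] t := by
  rw [hasDerivAt_pi]
  intro i
  fin_cases i
  · exact hasDerivAt_const _ _
  · exact hasDerivAt_const _ _
  · exact hasDerivAt_id _

/-- On the boundary of the cylinder the normal component of the convection field reduces to a
curvature term, for purely tangential as well as for purely normal boundary values. -/
theorem ncomp_convectionField {R : ℝ} (hR : 0 < R) {a c : V3 → C3}
    (hc : ∀ x ∈ bCyl R, ∀ i, DifferentiableAt ℝ (fun y => c y i) x)
    (hbc : (∀ x ∈ bCyl R, ncomp R x (a x) = 0 ∧ ncomp R x (c x) = 0) ∨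
           (∀ x ∈ bCyl R, (∀ i, a x i = ncomp R x (a x) * (nuR R x i : ℂ)) ∧
                          (∀ i, c x i = ncomp R x (c x) * (nuR R x i : ℂ)))) (θ t : ℝ) :
    ncomp R ![R * Real.cos θ, R * Real.sin θ, t]
        (convectionField a c ![R * Real.cos θ, R * Real.sin θ, t])
      = -(R : ℂ)⁻¹ * (a ![R * Real.cos θ, R * Real.sin θ, t] 0
            * c ![R * Real.cos θ, R * Real.sin θ, t] 0
          + a ![R * Real.cos θ, R * Real.sin θ, t] 1
            * c ![R * Real.cos θ, R * Real.sin θ, t] 1) := by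
  have hRc : (R : ℂ) ≠ 0 := by exact_mod_cast hR.ne'
  have hmem : ∀ θ t : ℝ, (![R * Real.cos θ, R * Real.sin θ, t] : V3) ∈ bCyl R := by
    intro θ t
    change (R * Real.cos θ) ^ 2 + (R * Real.sin θ) ^ 2 = R ^ 2
    linear_combination R ^ 2 * Real.cos_sq_add_sin_sq θ
  have hn : ∀ (θ t : ℝ) (z : C3), ncomp R ![R * Real.cos θ, R * Real.sin θ, t] z
      = z 0 * (Real.cos θ : ℂ) + z 1 * (Real.sin θ : ℂ) := by
    intro θ t z
    simp [ncomp, nuR, Fin.sum_univ_three, hRc]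
  have hν : ∀ θ t : ℝ, (nuR R ![R * Real.cos θ, R * Real.sin θ, t] 0 : ℂ) = Real.cos θ ∧
      (nuR R ![R * Real.cos θ, R * Real.sin θ, t] 1 : ℂ) = Real.sin θ ∧
      (nuR R ![R * Real.cos θ, R * Real.sin θ, t] 2 : ℂ) = 0 := by
    intro θ t
    simp [nuR, hRc]
  have hcos : HasDerivAt (fun θ : ℝ => (Real.cos θ : ℂ)) (-Real.sin θ : ℝ) θ :=
    (Real.hasDerivAt_cos θ).ofReal_comp
  have hsin : HasDerivAt (fun θ : ℝ => (Real.sin θ : ℂ)) (Real.cos θ : ℝ) θ :=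
    (Real.hasDerivAt_sin θ).ofReal_comp
  have hdθ := fun i => hasDerivAt_comp_curve (hc _ (hmem θ t) i) (hasDerivAt_bCyl_angle R t θ)
  have hdt := fun i => hasDerivAt_comp_curve (hc _ (hmem θ t) i) (hasDerivAt_bCyl_axis R t θ)
  have hcs : (Real.cos θ : ℂ) ^ 2 + (Real.sin θ : ℂ) ^ 2 = 1 := by
    exact_mod_cast Real.cos_sq_add_sin_sq θ
  rw [hn]
  rcases hbc with hbc | hbc
  · have h0 : ∀ θ t : ℝ, c ![R * Real.cos θ, R * Real.sin θ, t] 0 * (Real.cos θ : ℂ)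
        + c ![R * Real.cos θ, R * Real.sin θ, t] 1 * (Real.sin θ : ℂ) = 0 := by
      intro θ t
      rw [← hn]; exact (hbc _ (hmem θ t)).2
    have ha0 := (hbc _ (hmem θ t)).1
    rw [hn] at ha0
    have e1 := ((hdθ 0).mul hcos).add ((hdθ 1).mul hsin)
    have e1' := e1.unique ((hasDerivAt_const θ (0:ℂ)).congr_of_eventuallyEq
      (Filter.Eventually.of_forall fun θ => h0 θ t))
    have e2 := ((hdt 0).mul_const (Real.cos θ : ℂ)).add ((hdt 1).mul_const (Real.sin θ : ℂ))
    have e2' := e2.unique ((hasDerivAt_const t (0:ℂ)).congr_of_eventuallyEq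
      (Filter.Eventually.of_forall fun t => h0 θ t))
    have hc0 := h0 θ t
    clear e1 e2 hdθ hdt
    simp only [convectionField, vdiv, Fin.sum_univ_three] at *
    generalize (![R * Real.cos θ, R * Real.sin θ, t] : V3) = x at *
    simp at e1' e2'
    obtain ⟨τ, hτ0, hτ1⟩ : ∃ τ : ℂ, a x 0 = -(τ * Complex.sin θ) ∧ a x 1 = τ * Complex.cos θ := by
      push_cast at ha0 hcs
      refine ⟨a x 1 * Complex.cos θ - a x 0 * Complex.sin θ, ?_, ?_⟩
      · linear_combination Complex.cos θ * ha0 - a x 0 * hcs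
      · linear_combination Complex.sin θ * ha0 - a x 1 * hcs
    field_simp
    rw [hτ0, hτ1]
    push_cast
    linear_combination τ * e1' + a x 2 * R * e2'
  · have h0 : ∀ θ t : ℝ, c ![R * Real.cos θ, R * Real.sin θ, t] 1 * (Real.cos θ : ℂ)
        - c ![R * Real.cos θ, R * Real.sin θ, t] 0 * (Real.sin θ : ℂ) = 0 := by
      intro θ t
      have h := (hbc _ (hmem θ t)).2
      rw [h 0, h 1, (hν θ t).1, (hν θ t).2.1]
      ring
    have h2 : ∀ t : ℝ, c ![R * Real.cos θ, R * Real.sin θ, t] 2 = 0 := by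
      intro t
      rw [(hbc _ (hmem θ t)).2 2, (hν θ t).2.2, mul_zero]
    have ha := (hbc _ (hmem θ t)).1
    have ha0 := ha 0
    have ha1 := ha 1
    have ha2 := ha 2
    rw [hn, (hν θ t).1] at ha0
    rw [hn, (hν θ t).2.1] at ha1
    rw [hn, (hν θ t).2.2, mul_zero] at ha2
    have e1 := ((hdθ 1).mul hcos).sub ((hdθ 0).mul hsin)
    have e1' := e1.unique ((hasDerivAt_const θ (0:ℂ)).congr_of_eventuallyEq
      (Filter.Eventually.of_forall fun θ => h0 θ t))
    have e2' := (hdt 2).unique ((hasDerivAt_const t (0:ℂ)).congr_of_eventuallyEq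
      (Filter.Eventually.of_forall fun t => h2 t))
    have hc0 := h0 θ t
    clear e1 hdθ hdt
    simp only [convectionField, vdiv, Fin.sum_univ_three] at *
    generalize (![R * Real.cos θ, R * Real.sin θ, t] : V3) = x at *
    simp at e1' e2'
    obtain ⟨α, hα0, hα1⟩ : ∃ α : ℂ, a x 0 = α * Complex.cos θ ∧ a x 1 = α * Complex.sin θ :=
      ⟨_, by exact_mod_cast ha0, by exact_mod_cast ha1⟩
    field_simp
    rw [hα0, hα1, ha2]
    push_cast
    linear_combination -α * e1' - α * R * (Complex.cos θ ^ 2 + Complex.sin θ ^ 2) * e2'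

/-- Green-type identity for curl when on ∂Π either both normal components vanish
or both tangential components vanish; the boundary term becomes curvature R⁻¹ times
the cross-sectional part of ⟨a, b⟩. -/
theorem statement7 (R : ℝ) (hR : 0 < R) (a b : V3 → C3)
    (ha : UpTo 2 (Cyl R) a) (hb : UpTo 2 (Cyl R) b) (has : AxialSupp a)
    (hbc : (∀ x ∈ bCyl R, ncomp R x (a x) = 0 ∧ ncomp R x (b x) = 0) ∨
           (∀ x ∈ bCyl R, (∀ i, a x i = ncomp R x (a x) * (nuR R x i : ℂ)) ∧
                          (∀ i, b x i = ncomp R x (b x) * (nuR R x i : ℂ)))) :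
    ∫ x in Cyl R, hinner (vcurl a x) (vcurl b x)
      = (∫ x in Cyl R, ∑ j, hinner (pdV j a x) (pdV j b x))
        - (∫ x in Cyl R, vdiv a x * (starRingEnd ℂ) (vdiv b x))
        + (R : ℂ)⁻¹ * surfInt R (fun x =>
            a x 0 * (starRingEnd ℂ) (b x 0) + a x 1 * (starRingEnd ℂ) (b x 1)) := by
  obtain ⟨Ua, hUa, hKa, ha⟩ := ha
  obtain ⟨Ub, hUb, hKb, hb⟩ := hb
  set U := Ua ∩ Ub
  have hU : IsOpen U := hUa.inter hUb
  have hKU : {x : V3 | x 0 ^ 2 + x 1 ^ 2 ≤ R ^ 2} ⊆ U := fun x hx =>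
    ⟨hKa (closedCyl_subset_closure hR hx), hKb (closedCyl_subset_closure hR hx)⟩
  have hCU : ∀ x ∈ Cyl R, x ∈ U := fun x hx =>
    hKU (show x 0 ^ 2 + x 1 ^ 2 ≤ R ^ 2 from le_of_lt hx)
  set c : V3 → C3 := fun x i => (starRingEnd ℂ) (b x i)
  have ha' : ∀ i, ContDiffOn ℝ 2 (fun y => a y i) U := fun i =>
    contDiffOn_pi.1 (ha.mono Set.inter_subset_left) i
  have hc' : ∀ i, ContDiffOn ℝ 2 (fun y => c y i) U := fun i =>
    Complex.conjCLE.contDiff.comp_contDiffOn (contDiffOn_pi.1 (hb.mono Set.inter_subset_right) i)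
  have hda : ∀ i j, ContDiffOn ℝ 1 (pd j fun y => a y i) U := fun i j => by
    exact_mod_cast contDiffOn_pd (m := 1) (n := 2) hU (by exact_mod_cast ha' i) le_rfl j
  have hdc : ∀ i j, ContDiffOn ℝ 1 (pd j fun y => c y i) U := fun i j => by
    exact_mod_cast contDiffOn_pd (m := 1) (n := 2) hU (by exact_mod_cast hc' i) le_rfl j
  have hsa : ∀ i, AxialSupp fun y => a y i := fun i => by
    obtain ⟨T, hT, h⟩ := has
    exact ⟨T, hT, fun x hx => by simp [h x hx]⟩
  have hpdc : ∀ i j x, (starRingEnd ℂ) (pd j (fun y => b y i) x) = pd j (fun y => c y i) x :=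
    fun i j x => (pd_conj _ j x).symm
  have hbc' : (∀ x ∈ bCyl R, ncomp R x (a x) = 0 ∧ ncomp R x (c x) = 0) ∨
      (∀ x ∈ bCyl R, (∀ i, a x i = ncomp R x (a x) * (nuR R x i : ℂ)) ∧
        (∀ i, c x i = ncomp R x (c x) * (nuR R x i : ℂ))) := by
    have hn : ∀ x, ncomp R x (c x) = (starRingEnd ℂ) (ncomp R x (b x)) := fun x => by
      simp [ncomp, c]
    refine hbc.imp (fun h x hx => ⟨(h x hx).1, by rw [hn, (h x hx).2, map_zero]⟩)
      (fun h x hx => ⟨(h x hx).1, fun i => ?_⟩)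
    rw [hn]
    simpa using congrArg (starRingEnd ℂ) ((h x hx).2 i)
  have hdivc : ContDiffOn ℝ 1 (vdiv c) U := ContDiffOn.sum fun i _ => hdc i i
  have hF : ∀ j, ContDiffOn ℝ 1 (fun x => convectionField a c x j) U := fun j =>
    (ContDiffOn.sum fun i _ => ((ha' i).of_le one_le_two).mul (hdc j i)).sub
      (((ha' j).of_le one_le_two).mul hdivc)
  have hsF : ∀ j, AxialSupp (fun x => convectionField a c x j) := fun j =>
    (AxialSupp.sum fun i => (hsa i).mul_right _).sub ((hsa j).mul_right _)
  have hflux := integral_Cyl_divergence hR hU hKU hF hsF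
  have hgrad : IntegrableOn
      (fun x => ∑ j, ∑ i, pd j (fun y => a y i) x * pd j (fun y => c y i) x) (Cyl R) :=
    integrableOn_Cyl
      ((continuousOn_finsetSum _ fun j _ => continuousOn_finsetSum _ fun i _ =>
        (hda i j).continuousOn.mul (hdc i j).continuousOn).mono hKU)
      (AxialSupp.sum fun j => AxialSupp.sum fun i => ((hsa i).pd j).mul_right _)
  have hdiv : IntegrableOn (fun x => vdiv a x * vdiv c x) (Cyl R) :=
    integrableOn_Cyl
      (((continuousOn_finsetSum _ fun j _ => (hda j j).continuousOn).mul
        hdivc.continuousOn).mono hKU)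
      (AxialSupp.mul_right (AxialSupp.sum fun j => (hsa j).pd j) _)
  have hdivF : IntegrableOn (vdiv (convectionField a c)) (Cyl R) :=
    integrableOn_Cyl
      ((continuousOn_finsetSum _ fun j _ =>
        (contDiffOn_pd (m := 0) (n := 1) hU (by exact_mod_cast hF j)
          (by norm_num) j).continuousOn).mono hKU)
      (AxialSupp.sum fun j => (hsF j).pd j)
  have hcurl : ∫ x in Cyl R, hinner (vcurl a x) (vcurl b x)
      = ∫ x in Cyl R, (∑ j, ∑ i, pd j (fun y => a y i) x * pd j (fun y => c y i) x
          - vdiv a x * vdiv c x - vdiv (convectionField a c) x) := by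
    refine setIntegral_congr_fun (isOpen_Cyl R).measurableSet fun x hx => ?_
    rw [vdiv_convectionField hU ha' hc' (hCU x hx)]
    simp only [hinner, vcurl, Fin.sum_univ_three, Matrix.cons_val_zero, Matrix.cons_val_one,
      Matrix.cons_val, map_sub, hpdc]
    ring
  have hgrad_eq : ∀ x, ∑ j, hinner (pdV j a x) (pdV j b x)
      = ∑ j, ∑ i, pd j (fun y => a y i) x * pd j (fun y => c y i) x := by
    intro x
    simp only [hinner, pdV, hpdc]
  have hdiv_eq : ∀ x, (starRingEnd ℂ) (vdiv b x) = vdiv c x := by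
    intro x
    simp only [vdiv, map_sum, hpdc]
  have hsurf : surfInt R (fun x => ncomp R x (convectionField a c x))
      = -(R : ℂ)⁻¹ * surfInt R (fun x => a x 0 * c x 0 + a x 1 * c x 1) := by
    have hc1 : ∀ x ∈ bCyl R, ∀ i, DifferentiableAt ℝ (fun y => c y i) x := fun x hx i =>
      ((hc' i).differentiableOn two_ne_zero x (hKU (le_of_eq hx))).differentiableAt
        (hU.mem_nhds (hKU (le_of_eq hx)))
    simp only [surfInt, ncomp_convectionField hR hc1 hbc', mul_assoc,
      intervalIntegral.integral_const_mul, integral_const_mul]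
  have hsplit := integral_sub (hgrad.sub hdiv) hdivF
  simp only [Pi.sub_apply] at hsplit
  rw [hcurl, hsplit, integral_sub hgrad hdiv, hflux, hsurf]
  simp only [hgrad_eq, hdiv_eq]
  ring

end
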